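/- arXiv:2403.12716 — 2 statements merged into one kernel-verified Lean document; each statement's English description precedes it below -/
import Mathlib

section
/- Let R be a commutative ring, n : ℕ, D : ℕ, and p : MvPolynomial (Fin n) R with degreeOf i p < D for every i : Fin n. Then for every exponent tuple k : Fin n → ℕ with k i < D for all i, the coefficient of the monomial ∏_i (X i)^(k i) in p equals the coefficient of x^(∑_i k i * D^(i : ℕ)) in the univariate polynomial φ_D p. -/
open MvPolynomial Polynomial

/-- Standard Kronecker substitution: sends `X i` to `x ^ (D ^ i)`. -/
noncomputable def kroneckerSubst (R : Type*) [CommRing R] (n D : ℕ) :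
    MvPolynomial (Fin n) R →ₐ[R] Polynomial R :=
  MvPolynomial.aeval (fun i : Fin n => (Polynomial.X : Polynomial R) ^ (D ^ (i : ℕ)))

/-- Base-`D` expansions with `n` digits, all smaller than `D`, are unique. -/
theorem eq_of_sum_mul_pow_eq {n D : ℕ} {a b : Fin n → ℕ} (ha : ∀ i, a i < D) (hb : ∀ i, b i < D)
    (h : ∑ i : Fin n, a i * D ^ (i : ℕ) = ∑ i : Fin n, b i * D ^ (i : ℕ)) : a = b := by
  have key : (fun i => (⟨a i, ha i⟩ : Fin D)) = fun i => ⟨b i, hb i⟩ := by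
    apply finFunctionFinEquiv.injective
    apply Fin.ext
    simpa only [finFunctionFinEquiv_apply] using h
  funext i
  exact congrArg Fin.val (congrFun key i)

theorem coeff_kroneckerSubst {R : Type*} [CommRing R] (n D : ℕ) (p : MvPolynomial (Fin n) R)
    (m : ℕ) :
    (kroneckerSubst R n D p).coeff m =
      ∑ d ∈ p.support, if m = ∑ i : Fin n, d i * D ^ (i : ℕ) then p.coeff d else 0 := by
  rw [kroneckerSubst, MvPolynomial.aeval_def, MvPolynomial.eval₂_eq', Polynomial.finsetSum_coeff]
  refine Finset.sum_congr rfl fun d _ => ?_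
  simp_rw [← pow_mul, Finset.prod_pow_eq_pow_sum, Polynomial.algebraMap_eq,
    Polynomial.coeff_C_mul_X_pow, mul_comm (D ^ _)]

theorem stmt_4 {R : Type*} [CommRing R] (n D : ℕ)
    (p : MvPolynomial (Fin n) R) (hp : ∀ i : Fin n, p.degreeOf i < D)
    (k : Fin n → ℕ) (hk : ∀ i : Fin n, k i < D) :
    MvPolynomial.coeff (Finsupp.equivFunOnFinite.symm k) p =
      (kroneckerSubst R n D p).coeff (∑ i : Fin n, k i * D ^ (i : ℕ)) := by
  rw [coeff_kroneckerSubst, Finset.sum_eq_single (Finsupp.equivFunOnFinite.symm k)]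
  · simp
  · intro d hd hne
    refine if_neg fun h => hne ?_
    have hdlt : ∀ i, d i < D := fun i =>
      (MvPolynomial.monomial_le_degreeOf i hd).trans_lt (hp i)
    rw [eq_of_sum_mul_pow_eq hk hdlt h]
    ext i
    rfl
  · intro h
    simp [MvPolynomial.notMem_support_iff.mp h]
end

section
/- Let R be a commutative ring, n : ℕ, h : MvPolynomial (Fin n) R nonzero, and i, j : Fin n with i ≠ j. Let D : ℕ with D > degreeOf j h and let ψ = ψ_{i→j,D}. Then degreeOf j (ψ h) equals the maximum, over all exponent vectors v in the support of h, of v i * D + v j. -/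
open MvPolynomial

/-- Single Kronecker substitution: sends `X i` to `(X j) ^ D` and fixes every other variable. -/
noncomputable def singleKron (R : Type*) [CommRing R] {n : ℕ} (i j : Fin n) (D : ℕ) :
    MvPolynomial (Fin n) R →ₐ[R] MvPolynomial (Fin n) R :=
  MvPolynomial.aeval (fun m : Fin n =>
    if m = i then (MvPolynomial.X j : MvPolynomial (Fin n) R) ^ D else MvPolynomial.X m)

/-- The exponent vector of the image of the monomial with exponent vector `v` under
`singleKron R i j D`. -/
noncomputable def singleKronExponent {n : ℕ} (i j : Fin n) (D : ℕ) (v : Fin n →₀ ℕ) :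
    Fin n →₀ ℕ :=
  Finsupp.single j (v i * D) + v.erase i

theorem singleKronExponent_apply_right {n : ℕ} {i j : Fin n} (hij : i ≠ j) (D : ℕ)
    (v : Fin n →₀ ℕ) : singleKronExponent i j D v j = v i * D + v j := by
  simp [singleKronExponent, Finsupp.erase_ne hij.symm]

theorem singleKronExponent_apply_of_ne {n : ℕ} {i j m : Fin n} (hi : m ≠ i) (hj : m ≠ j) (D : ℕ)
    (v : Fin n →₀ ℕ) : singleKronExponent i j D v m = v m := by
  simp [singleKronExponent, Finsupp.erase_ne hi, Finsupp.single_eq_of_ne hj]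

theorem singleKronExponent_injOn {n : ℕ} {i j : Fin n} (hij : i ≠ j) (D : ℕ) :
    Set.InjOn (singleKronExponent i j D) {v | v j < D} := by
  intro v hv w hw h
  simp only [Set.mem_ofPred_eq] at hv hw
  have key : v i * D + v j = w i * D + w j := by
    rw [← singleKronExponent_apply_right hij, h, singleKronExponent_apply_right hij]
  have hj : v j = w j := by
    simpa [Nat.mul_add_mod_self_right, Nat.mod_eq_of_lt hv, Nat.mod_eq_of_lt hw]
      using congrArg (· % D) key
  have hi : v i = w i :=
    Nat.eq_of_mul_eq_mul_right (Nat.zero_lt_of_lt hv) (by omega)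
  ext m
  by_cases hmi : m = i
  · rw [hmi, hi]
  by_cases hmj : m = j
  · rw [hmj, hj]
  rw [← singleKronExponent_apply_of_ne hmi hmj D v, h, singleKronExponent_apply_of_ne hmi hmj]

theorem singleKron_monomial {R : Type*} [CommRing R] {n : ℕ} (i j : Fin n) (D : ℕ)
    (v : Fin n →₀ ℕ) (a : R) :
    singleKron R i j D (monomial v a) = monomial (singleKronExponent i j D v) a := by
  have herase : ((v.erase i).prod fun m k =>
      (if m = i then (X j : MvPolynomial (Fin n) R) ^ D else X m) ^ k) =
      (v.erase i).prod fun m k => X m ^ k := by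
    refine Finsupp.prod_congr fun m hm => ?_
    rw [if_neg]
    rintro rfl
    simp at hm
  rw [singleKron, aeval_monomial, ← Finsupp.mul_prod_erase' v i _ fun _ => pow_zero _, herase,
    if_pos rfl, ← pow_mul, mul_comm D, X_pow_eq_monomial, singleKronExponent, algebraMap_eq,
    mul_left_comm, ← monomial_eq, monomial_mul, one_mul]

theorem support_singleKron {R : Type*} [CommRing R] {n : ℕ} (h : MvPolynomial (Fin n) R)
    {i j : Fin n} (hij : i ≠ j) {D : ℕ} (hD : h.degreeOf j < D) :
    (singleKron R i j D h).support = h.support.image (singleKronExponent i j D) := by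
  have hsum : singleKron R i j D h =
      ∑ v ∈ h.support, monomial (singleKronExponent i j D v) (h.coeff v) := by
    conv_lhs => rw [h.as_sum, map_sum]
    simp only [singleKron_monomial]
  have hlt : ∀ v ∈ h.support, v j < D :=
    (degreeOf_lt_iff (Nat.zero_lt_of_lt hD)).1 hD
  ext w
  simp only [Finset.mem_image]
  constructor
  · intro hw
    by_contra! hne
    refine mem_support_iff.1 hw ?_
    rw [hsum, coeff_sum]
    exact Finset.sum_eq_zero fun v hv => by rw [coeff_monomial, if_neg (hne v hv)]
  · rintro ⟨v, hv, rfl⟩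
    rw [mem_support_iff, hsum, coeff_sum, Finset.sum_eq_single_of_mem v hv, coeff_monomial,
      if_pos rfl]
    · exact mem_support_iff.1 hv
    · intro u hu huv
      rw [coeff_monomial, if_neg]
      exact fun he => huv (singleKronExponent_injOn hij D (hlt u hu) (hlt v hv) he)

theorem stmt_8 {R : Type*} [CommRing R] {n : ℕ} (h : MvPolynomial (Fin n) R)
    (hh : h ≠ 0) (i j : Fin n) (hij : i ≠ j) (D : ℕ) (hD : h.degreeOf j < D) :
    (singleKron R i j D h).degreeOf j =
      h.support.sup (fun v => v i * D + v j) := by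
  rw [degreeOf_eq_sup, support_singleKron h hij hD, Finset.sup_image]
  exact Finset.sup_congr rfl fun v _ => singleKronExponent_apply_right hij D v
end
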